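/- The function ψ solves the ordinary differential equation (σ²/2)ψ''(x) + κ(ζ−x)ψ'(x) − ρψ(x) = 0 for every x ∈ ℝ. -/

import Mathlib

open Real MeasureTheory

theorem integrableOn_rpow_mul_exp_neg_sq_div_two_add_mul {s : ℝ} (hs : -1 < s) (y : ℝ) :
    IntegrableOn (fun t : ℝ => t ^ s * Real.exp (-t ^ 2 / 2 + y * t)) (Set.Ioi 0) := by
  have h := (integrableOn_rpow_mul_exp_neg_mul_sq (b := 1 / 4) (by norm_num) hs).const_mul
    (Real.exp (y ^ 2))
  refine Integrable.mono' h (by fun_prop) ?_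
  refine (ae_restrict_iff' measurableSet_Ioi).2 (.of_forall fun t ht => ?_)
  have ht0 : 0 < t := ht
  have hp : 0 < t ^ s := rpow_pos_of_pos ht0 s
  rw [Real.norm_of_nonneg (by positivity), mul_left_comm, ← Real.exp_add]
  refine mul_le_mul_of_nonneg_left (Real.exp_le_exp.2 ?_) hp.le
  nlinarith [sq_nonneg (t / 2 - y)]

theorem hasDerivAt_integral_rpow_mul_exp_neg_sq_div_two_add_mul {s : ℝ} (hs : -1 < s) (y : ℝ) :
    HasDerivAt
      (fun y : ℝ => ∫ t in Set.Ioi (0 : ℝ), t ^ s * Real.exp (-t ^ 2 / 2 + y * t))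
      (∫ t in Set.Ioi (0 : ℝ), t ^ (s + 1) * Real.exp (-t ^ 2 / 2 + y * t)) y := by
  refine (hasDerivAt_integral_of_dominated_loc_of_deriv_le
    (F := fun y t : ℝ => t ^ s * Real.exp (-t ^ 2 / 2 + y * t))
    (F' := fun y t : ℝ => t ^ (s + 1) * Real.exp (-t ^ 2 / 2 + y * t))
    (bound := fun t : ℝ => t ^ (s + 1) * Real.exp (-t ^ 2 / 2 + (y + 1) * t))
    (Metric.ball_mem_nhds y one_pos) (.of_forall fun z => by fun_prop)
    (integrableOn_rpow_mul_exp_neg_sq_div_two_add_mul hs y) (by fun_prop) ?_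
    (integrableOn_rpow_mul_exp_neg_sq_div_two_add_mul (by linarith) (y + 1)) ?_).2
  · refine (ae_restrict_iff' measurableSet_Ioi).2 (.of_forall fun t ht z hz => ?_)
    have ht0 : 0 < t := ht
    have hp : 0 < t ^ (s + 1) := rpow_pos_of_pos ht0 _
    rw [Metric.mem_ball, Real.dist_eq, abs_lt] at hz
    rw [Real.norm_of_nonneg (by positivity)]
    gcongr
    linarith [hz.2]
  · refine (ae_restrict_iff' measurableSet_Ioi).2 (.of_forall fun t ht z _ => ?_)
    have ht0 : 0 < t := ht
    have h := ((((hasDerivAt_id z).mul_const t).const_add (-t ^ 2 / 2)).exp).const_mul (t ^ s)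
    refine h.congr_deriv ?_
    rw [rpow_add_one ht0.ne']
    simp only [id]
    ring

/-- Integration by parts for the moments of `exp (-t ^ 2 / 2 + y * t)` on the half-line. -/
theorem integral_rpow_mul_exp_neg_sq_div_two_add_mul_recurrence {s : ℝ} (hs : -1 < s) (y : ℝ) :
    ∫ t in Set.Ioi (0 : ℝ), t ^ (s + 1 + 1) * Real.exp (-t ^ 2 / 2 + y * t) =
      (s + 1) * (∫ t in Set.Ioi (0 : ℝ), t ^ s * Real.exp (-t ^ 2 / 2 + y * t)) +
      y * ∫ t in Set.Ioi (0 : ℝ), t ^ (s + 1) * Real.exp (-t ^ 2 / 2 + y * t) := by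
  have i0 := (integrableOn_rpow_mul_exp_neg_sq_div_two_add_mul hs y).const_mul (s + 1)
  have i1 := integrableOn_rpow_mul_exp_neg_sq_div_two_add_mul (s := s + 1) (by linarith) y
  have i1' := i1.const_mul y
  have i2 := integrableOn_rpow_mul_exp_neg_sq_div_two_add_mul (s := s + 1 + 1) (by linarith) y
  have hd : ∀ t ∈ Set.Ioi (0 : ℝ),
      HasDerivAt (fun t : ℝ => t ^ (s + 1) * Real.exp (-t ^ 2 / 2 + y * t))
        ((s + 1) * (t ^ s * Real.exp (-t ^ 2 / 2 + y * t)) +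
          y * (t ^ (s + 1) * Real.exp (-t ^ 2 / 2 + y * t)) -
          t ^ (s + 1 + 1) * Real.exp (-t ^ 2 / 2 + y * t)) t := by
    intro t ht
    have ht0 : 0 < t := ht
    have he : HasDerivAt (fun t : ℝ => -t ^ 2 / 2 + y * t) (-t + y) t := by
      have h := (((hasDerivAt_pow 2 t).neg).div_const 2).add ((hasDerivAt_id t).const_mul y)
      refine h.congr_deriv ?_
      norm_num
      ring
    refine ((hasDerivAt_rpow_const (p := s + 1) (Or.inl ht0.ne')).mul he.exp).congr_deriv ?_
    rw [rpow_add_one ht0.ne' (s + 1), add_sub_cancel_right]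
    ring
  have hint := (i0.add i1').sub i2
  have hlim := tendsto_zero_of_hasDerivAt_of_integrableOn_Ioi hd hint i1
  have hcont : ContinuousWithinAt (fun t : ℝ => t ^ (s + 1) * Real.exp (-t ^ 2 / 2 + y * t))
      (Set.Ici 0) 0 := by
    refine ContinuousAt.continuousWithinAt (ContinuousAt.mul ?_ (by fun_prop))
    exact continuousAt_rpow_const _ _ (Or.inr (by linarith))
  have h := integral_Ioi_of_hasDerivAt_of_tendsto hcont hd hint hlim
  rw [integral_sub (by exact i0.add i1') i2, integral_add i0 i1', integral_const_mul, integral_const_mul,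
    zero_rpow (by linarith)] at h
  linarith

/-- `ψ` solves the ODE `(σ²/2)ψ'' + κ(ζ−x)ψ' − ρψ = 0` on `ℝ`. -/
theorem psi_solves_ode
    (κ σ ρ ζ : ℝ) (hκ : 0 < κ) (hσ : 0 < σ) (hρ : 0 < ρ)
    (ψ : ℝ → ℝ)
    (hψ : ∀ x : ℝ, ψ x = (Real.Gamma (ρ / κ))⁻¹ *
      ∫ t in Set.Ioi (0 : ℝ), t ^ (ρ / κ - 1) *
        Real.exp (-t ^ 2 / 2 + ((x - ζ) * Real.sqrt (2 * κ) / σ) * t)) :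
    ∀ x : ℝ,
      σ ^ 2 / 2 * iteratedDeriv 2 ψ x + κ * (ζ - x) * deriv ψ x - ρ * ψ x = 0 := by
  intro x
  have hs : -1 < ρ / κ - 1 := by linarith [div_pos hρ hκ]
  have hy : ∀ x, HasDerivAt (fun x => (x - ζ) * √(2 * κ) / σ) (√(2 * κ) / σ) x := fun x =>
    ((((hasDerivAt_id x).sub_const ζ).mul_const (√(2 * κ))).div_const σ).congr_deriv (by simp)
  have hcomp : ∀ s : ℝ, -1 < s → ∀ x, HasDerivAt
      (fun x => ∫ t in Set.Ioi (0 : ℝ), t ^ s *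
        Real.exp (-t ^ 2 / 2 + ((x - ζ) * √(2 * κ) / σ) * t))
      ((∫ t in Set.Ioi (0 : ℝ), t ^ (s + 1) *
        Real.exp (-t ^ 2 / 2 + ((x - ζ) * √(2 * κ) / σ) * t)) * (√(2 * κ) / σ)) x :=
    fun s hs x => HasDerivAt.comp x
      (hasDerivAt_integral_rpow_mul_exp_neg_sq_div_two_add_mul hs _) (hy x)
  have h1 : deriv ψ = fun x => (Real.Gamma (ρ / κ))⁻¹ *
      ((∫ t in Set.Ioi (0 : ℝ), t ^ (ρ / κ - 1 + 1) *
        Real.exp (-t ^ 2 / 2 + ((x - ζ) * √(2 * κ) / σ) * t)) * (√(2 * κ) / σ)) := by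
    funext x
    rw [funext hψ]
    exact ((hcomp _ hs x).const_mul _).deriv
  have h2 := (((hcomp (ρ / κ - 1 + 1) (by linarith) x).mul_const (√(2 * κ) / σ)).const_mul
    (Real.Gamma (ρ / κ))⁻¹).deriv
  rw [iteratedDeriv_succ, iteratedDeriv_one, h1, h2, hψ x,
    integral_rpow_mul_exp_neg_sq_div_two_add_mul_recurrence hs]
  beta_reduce
  have hsq : √(2 * κ) ^ 2 = 2 * κ := Real.sq_sqrt (by linarith)
  generalize (∫ t in Set.Ioi (0 : ℝ), t ^ (ρ / κ - 1) *
        Real.exp (-t ^ 2 / 2 + ((x - ζ) * √(2 * κ) / σ) * t)) = A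
  generalize (∫ t in Set.Ioi (0 : ℝ), t ^ (ρ / κ - 1 + 1) *
        Real.exp (-t ^ 2 / 2 + ((x - ζ) * √(2 * κ) / σ) * t)) = B
  generalize (Real.Gamma (ρ / κ))⁻¹ = G
  generalize √(2 * κ) = r at hsq ⊢
  have hκr : κ = r ^ 2 / 2 := by linarith
  have hr : r ≠ 0 := by
    rintro rfl
    norm_num at hsq
    exact hκ.ne' hsq
  subst hκr
  field_simp
  ring
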